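/- Let n ≥ 1 and let μ_0, μ_1, …, μ_n be probability measures on X, where μ_0 is the marginal of the target distribution of a task and μ_k (for 1 ≤ k ≤ n) is the marginal of the source distribution after k rounds of generative-replay refinement. For each 0 ≤ k ≤ n let f_k : X → Y be the true labeling function of the k-th distribution and let h_k ∈ H minimize the risk R(·, μ_k, f_k) over H. Then for every classifier h ∈ H the accumulated-error bound holds: R(h, μ_0, f_0) ≤ R'(h, h_n, μ_n) + Σ_{k=0}^{n−1} [ Ψ(μ_k, μ_{k+1}) + σ_k ], where σ_k = R'(h_k, f_k, μ_k) + R'(h_k, h_{k+1}, μ_{k+1}). -/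

import Mathlib

open MeasureTheory Finset

/-- `R'(f, g, μ) = ∫ τ(f(x), g(x)) dμ(x)`. -/
noncomputable def Rp {X Y : Type*} [MeasurableSpace X] (τ : Y → Y → ℝ)
    (f g : X → Y) (μ : Measure X) : ℝ := ∫ x, τ (f x) (g x) ∂μ

/-- Discrepancy distance `Ψ(μ, ν)` w.r.t. loss `τ` and hypothesis class `H`. -/
noncomputable def disc {X Y : Type*} [MeasurableSpace X] (τ : Y → Y → ℝ)
    (H : Set (X → Y)) (μ ν : Measure X) : ℝ :=
  sSup {r : ℝ | ∃ h ∈ H, ∃ h' ∈ H,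
    r = |(∫ x, τ (h' x) (h x) ∂μ) - ∫ x, τ (h' x) (h x) ∂ν|}

theorem integrable_loss {X Y : Type*} [MeasurableSpace X] {τ : Y → Y → ℝ} {M' : ℝ}
    (hbd : ∀ y y' : Y, 0 ≤ τ y y' ∧ τ y y' ≤ M') {p q : X → Y}
    (hm : Measurable fun x => τ (p x) (q x)) (ν : Measure X) [IsFiniteMeasure ν] :
    Integrable (fun x => τ (p x) (q x)) ν :=
  Integrable.of_bound hm.aestronglyMeasurable M' <| Filter.Eventually.of_forall fun x => by
    rw [Real.norm_eq_abs, abs_of_nonneg (hbd _ _).1]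
    exact (hbd _ _).2

theorem Rp_nonneg {X Y : Type*} [MeasurableSpace X] {τ : Y → Y → ℝ}
    (hτ : ∀ y y' : Y, 0 ≤ τ y y') (p q : X → Y) (ν : Measure X) : 0 ≤ Rp τ p q ν :=
  integral_nonneg fun _ => hτ _ _

theorem Rp_le {X Y : Type*} [MeasurableSpace X] {τ : Y → Y → ℝ} {M' : ℝ}
    (hbd : ∀ y y' : Y, 0 ≤ τ y y' ∧ τ y y' ≤ M') {p q : X → Y}
    (hm : Measurable fun x => τ (p x) (q x)) (ν : Measure X) [IsProbabilityMeasure ν] :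
    Rp τ p q ν ≤ M' := by
  have := integral_mono (integrable_loss hbd hm ν) (integrable_const M')
    fun x => (hbd (p x) (q x)).2
  simpa [Rp] using this

theorem Rp_comm {X Y : Type*} [MeasurableSpace X] {τ : Y → Y → ℝ}
    (hsym : ∀ y y' : Y, τ y y' = τ y' y) (p q : X → Y) (ν : Measure X) :
    Rp τ p q ν = Rp τ q p ν :=
  integral_congr_ae <| Filter.Eventually.of_forall fun _ => hsym _ _

theorem Rp_triangle {X Y : Type*} [MeasurableSpace X] {τ : Y → Y → ℝ}
    (htri : ∀ y y' y'' : Y, τ y y'' ≤ τ y y' + τ y' y'') {p q r : X → Y} {ν : Measure X}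
    (hpq : Integrable (fun x => τ (p x) (q x)) ν)
    (hqr : Integrable (fun x => τ (q x) (r x)) ν)
    (hpr : Integrable (fun x => τ (p x) (r x)) ν) :
    Rp τ p r ν ≤ Rp τ p q ν + Rp τ q r ν := by
  unfold Rp
  rw [← integral_add hpq hqr]
  exact integral_mono hpr (hpq.add hqr) fun _ => htri _ _ _

theorem Rp_le_Rp_add_disc {X Y : Type*} [MeasurableSpace X] {τ : Y → Y → ℝ} {M' : ℝ}
    (hbd : ∀ y y' : Y, 0 ≤ τ y y' ∧ τ y y' ≤ M') {H : Set (X → Y)}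
    (hm : ∀ p ∈ H, ∀ q ∈ H, Measurable fun x => τ (p x) (q x))
    (ν ρ : Measure X) [IsProbabilityMeasure ν] [IsProbabilityMeasure ρ]
    {p q : X → Y} (hp : p ∈ H) (hq : q ∈ H) :
    Rp τ p q ν ≤ Rp τ p q ρ + disc τ H ν ρ := by
  have hbdd : BddAbove {r : ℝ | ∃ h ∈ H, ∃ h' ∈ H,
      r = |(∫ x, τ (h' x) (h x) ∂ν) - ∫ x, τ (h' x) (h x) ∂ρ|} := by
    refine ⟨M', ?_⟩
    rintro _ ⟨g, hg, g', hg', rfl⟩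
    have h0 (κ : Measure X) := Rp_nonneg (fun y y' => (hbd y y').1) g' g κ
    have h1 := Rp_le hbd (hm g' hg' g hg) ν
    have h2 := Rp_le hbd (hm g' hg' g hg) ρ
    change |Rp τ g' g ν - Rp τ g' g ρ| ≤ M'
    rw [abs_le]
    constructor <;> linarith [h0 ν, h0 ρ]
  have hle : |Rp τ p q ν - Rp τ p q ρ| ≤ disc τ H ν ρ :=
    le_csSup hbdd ⟨q, hq, p, hp, rfl⟩
  linarith [le_abs_self (Rp τ p q ν - Rp τ p q ρ)]

/-- Theorem 2: accumulated-error bound along a chain of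
generative-replay refinements of a single task. -/
theorem accumulated_error_bound {X Y : Type*} [MeasurableSpace X]
    (τ : Y → Y → ℝ) (M' : ℝ) (hM : 0 < M')
    (hbd : ∀ y y' : Y, 0 ≤ τ y y' ∧ τ y y' ≤ M')
    (hsym : ∀ y y' : Y, τ y y' = τ y' y)
    (htri : ∀ y y' y'' : Y, τ y y'' ≤ τ y y' + τ y' y'')
    (H : Set (X → Y)) (hH : H.Nonempty)
    (n : ℕ) (hn : 1 ≤ n)
    (μ : ℕ → Measure X) (hprob : ∀ k ≤ n, IsProbabilityMeasure (μ k))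
    (f : ℕ → X → Y) (hc : ℕ → X → Y)
    (hcH : ∀ k ≤ n, hc k ∈ H)
    (hcMin : ∀ k ≤ n, ∀ h' ∈ H,
      Rp τ (hc k) (f k) (μ k) ≤ Rp τ h' (f k) (μ k))
    (hMeas : ∀ p q : X → Y,
      (p ∈ H ∨ ∃ k, p = f k) → (q ∈ H ∨ ∃ k, q = f k) →
      Measurable fun x => τ (p x) (q x))
    (h : X → Y) (hhH : h ∈ H) :
    Rp τ h (f 0) (μ 0) ≤
      Rp τ h (hc n) (μ n) +
        ∑ k ∈ Finset.range n,
          (disc τ H (μ k) (μ (k + 1)) +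
            (Rp τ (hc k) (f k) (μ k) +
              Rp τ (hc k) (hc (k + 1)) (μ (k + 1)))) := by
  have hτ : ∀ y y' : Y, 0 ≤ τ y y' := fun y y' => (hbd y y').1
  have hmH : ∀ p ∈ H, ∀ q ∈ H, Measurable fun x => τ (p x) (q x) :=
    fun p hp q hq => hMeas p q (.inl hp) (.inl hq)
  have chain : ∀ m ≤ n, Rp τ h (hc 0) (μ 0) ≤ Rp τ h (hc m) (μ m) +
      ∑ k ∈ Finset.range m,
        (disc τ H (μ k) (μ (k + 1)) + Rp τ (hc k) (hc (k + 1)) (μ (k + 1))) := by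
    intro m
    induction m with
    | zero => simp
    | succ m ih =>
      intro hmn
      have := hprob m (by omega)
      have := hprob (m + 1) hmn
      have hm := hcH m (by omega)
      have hm1 := hcH (m + 1) hmn
      have hshift := Rp_le_Rp_add_disc hbd hmH (μ m) (μ (m + 1)) hhH hm
      have htriangle := Rp_triangle htri
        (integrable_loss hbd (hmH _ hhH _ hm1) (μ (m + 1)))
        (integrable_loss hbd (hmH _ hm1 _ hm) (μ (m + 1)))
        (integrable_loss hbd (hmH _ hhH _ hm) (μ (m + 1)))
      rw [Rp_comm hsym (hc (m + 1)) (hc m)] at htriangle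
      rw [Finset.sum_range_succ]
      linarith [ih (by omega)]
  have hfit : Rp τ (hc 0) (f 0) (μ 0) ≤ ∑ k ∈ Finset.range n, Rp τ (hc k) (f k) (μ k) :=
    Finset.single_le_sum (f := fun k => Rp τ (hc k) (f k) (μ k))
      (fun k _ => Rp_nonneg hτ _ _ _) (Finset.mem_range.2 hn)
  have := hprob 0 (Nat.zero_le n)
  have h0 := hcH 0 (Nat.zero_le n)
  have hstart := Rp_triangle htri
    (integrable_loss hbd (hmH _ hhH _ h0) (μ 0))
    (integrable_loss hbd (hMeas _ _ (.inl h0) (.inr ⟨0, rfl⟩)) (μ 0))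
    (integrable_loss hbd (hMeas _ _ (.inl hhH) (.inr ⟨0, rfl⟩)) (μ 0))
  have hchain := chain n le_rfl
  simp only [Finset.sum_add_distrib] at hchain ⊢
  linarith
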